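/- arXiv:2104.10528 — 2 statements merged into one kernel-verified Lean document; each statement's English description precedes it below -/
import Mathlib

section
/- Let k ≥ 0. Then f_k maps [0,1] into [0,1], the set of fixed points of f_k in [0,1] is nonempty and possesses a smallest element α_p(k), and the sequence of iterates a_t = f_k^{t+1}(0) (i.e. a_0 = f_k(0) and a_{t+1} = f_k(a_t)) is non-decreasing and converges to α_p(k). -/
open MeasureTheory Set Filter Topology
open scoped ENNReal NNReal

/-- The space `S = {I,II} × [0,∞) × ℕ`; `true` stands for Player I,
`false` for Player II. -/
abbrev GameS : Type := Bool × ℝ≥0 × ℕ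

/-- `pk p i k n = p({ι = i} ∩ {γ ≥ k} ∩ {ξ = n})`. -/
noncomputable def pk (p : Measure GameS) (i : Bool) (k : ℝ≥0) (n : ℕ) : ℝ :=
  (p {s : GameS | s.1 = i ∧ k ≤ s.2.1 ∧ s.2.2 = n}).toReal

/-- The generating function `G_i(k,x) = Σ_n p_i(k,n) xⁿ`. -/
noncomputable def Gk (p : Measure GameS) (i : Bool) (k : ℝ≥0) (x : ℝ) : ℝ :=
  ∑' n : ℕ, pk p i k n * x ^ n

/-- The value generating function
`f(k,x) = 1 − G_I(k,0) − G_I(k,1) + G_I(k,x) − G_II(k,1−x)`. -/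
noncomputable def vgf (p : Measure GameS) (k : ℝ≥0) (x : ℝ) : ℝ :=
  1 - Gk p true k 0 - Gk p true k 1 + Gk p true k x - Gk p false k (1 - x)


lemma pk_nonneg (p : Measure GameS) (i : Bool) (k : ℝ≥0) (n : ℕ) : 0 ≤ pk p i k n :=
  ENNReal.toReal_nonneg

lemma hasSum_pk (p : Measure GameS) [IsProbabilityMeasure p] (i : Bool) (k : ℝ≥0) :
    HasSum (pk p i k) (p.real {s : GameS | s.1 = i ∧ k ≤ s.2.1}) := by
  have hU : {s : GameS | s.1 = i ∧ k ≤ s.2.1} =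
      ⋃ n : ℕ, {s : GameS | s.1 = i ∧ k ≤ s.2.1 ∧ s.2.2 = n} := by
    ext s
    simp
  have hm (n : ℕ) : MeasurableSet {s : GameS | s.1 = i ∧ k ≤ s.2.1 ∧ s.2.2 = n} := by
    measurability
  have hd : Pairwise (Function.onFun Disjoint
      fun n : ℕ => {s : GameS | s.1 = i ∧ k ≤ s.2.1 ∧ s.2.2 = n}) := by
    intro m n hmn
    refine Set.disjoint_left.2 fun s hs ht => hmn ?_
    exact hs.2.2.symm.trans ht.2.2
  have hsum := measure_iUnion (μ := p) hd hm
  rw [measureReal_def, hU, hsum, ENNReal.tsum_toReal_eq fun n => measure_ne_top _ _]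
  refine ENNReal.hasSum_toReal ?_
  rw [← hsum]
  exact measure_ne_top _ _

lemma Gk_one (p : Measure GameS) [IsProbabilityMeasure p] (i : Bool) (k : ℝ≥0) :
    Gk p i k 1 = p.real {s : GameS | s.1 = i ∧ k ≤ s.2.1} := by
  simpa [Gk] using (hasSum_pk p i k).tsum_eq

lemma Gk_true_one_add_Gk_false_one_le_one (p : Measure GameS) [IsProbabilityMeasure p]
    (k : ℝ≥0) : Gk p true k 1 + Gk p false k 1 ≤ 1 := by
  have hm : MeasurableSet {s : GameS | s.1 = false ∧ k ≤ s.2.1} := by measurability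
  rw [Gk_one, Gk_one, ← measureReal_union _ hm]
  · exact measureReal_le_one
  · refine Set.disjoint_left.2 fun s hs ht => ?_
    simpa using hs.1.symm.trans ht.1

lemma Gk_nonneg (p : Measure GameS) (i : Bool) (k : ℝ≥0) {x : ℝ} (hx : 0 ≤ x) :
    0 ≤ Gk p i k x :=
  tsum_nonneg fun n => mul_nonneg (pk_nonneg p i k n) (pow_nonneg hx n)

lemma pk_mul_pow_le (p : Measure GameS) (i : Bool) (k : ℝ≥0) {x : ℝ} (hx : x ∈ Icc (0 : ℝ) 1)
    (n : ℕ) : pk p i k n * x ^ n ≤ pk p i k n :=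
  mul_le_of_le_one_right (pk_nonneg p i k n) (pow_le_one₀ hx.1 hx.2)

lemma summable_pk_mul_pow (p : Measure GameS) [IsProbabilityMeasure p] (i : Bool) (k : ℝ≥0)
    {x : ℝ} (hx : x ∈ Icc (0 : ℝ) 1) : Summable fun n => pk p i k n * x ^ n :=
  (hasSum_pk p i k).summable.of_nonneg_of_le
    (fun n => mul_nonneg (pk_nonneg p i k n) (pow_nonneg hx.1 n)) (pk_mul_pow_le p i k hx)

lemma monotoneOn_Gk (p : Measure GameS) [IsProbabilityMeasure p] (i : Bool) (k : ℝ≥0) :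
    MonotoneOn (Gk p i k) (Icc 0 1) := fun _ hx _ hy hxy =>
  (summable_pk_mul_pow p i k hx).tsum_le_tsum
    (fun n => mul_le_mul_of_nonneg_left (pow_le_pow_left₀ hx.1 hxy n) (pk_nonneg p i k n))
    (summable_pk_mul_pow p i k hy)

lemma continuousOn_Gk (p : Measure GameS) [IsProbabilityMeasure p] (i : Bool) (k : ℝ≥0) :
    ContinuousOn (Gk p i k) (Icc 0 1) := by
  refine continuousOn_tsum (fun n => by fun_prop) (hasSum_pk p i k).summable fun n x hx => ?_
  rw [Real.norm_of_nonneg (mul_nonneg (pk_nonneg p i k n) (pow_nonneg hx.1 n))]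
  exact pk_mul_pow_le p i k hx n

lemma mapsTo_one_sub_Icc : MapsTo (fun x : ℝ => 1 - x) (Icc 0 1) (Icc 0 1) :=
  fun _ hx => ⟨sub_nonneg.2 hx.2, sub_le_self _ hx.1⟩

lemma monotoneOn_vgf (p : Measure GameS) [IsProbabilityMeasure p] (k : ℝ≥0) :
    MonotoneOn (vgf p k) (Icc 0 1) := by
  intro x hx y hy hxy
  have h₁ := monotoneOn_Gk p true k hx hy hxy
  have h₂ := monotoneOn_Gk p false k (mapsTo_one_sub_Icc hy) (mapsTo_one_sub_Icc hx)
    (sub_le_sub_left hxy 1)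
  simp only [vgf]
  linarith

lemma continuousOn_vgf (p : Measure GameS) [IsProbabilityMeasure p] (k : ℝ≥0) :
    ContinuousOn (vgf p k) (Icc 0 1) :=
  (continuousOn_const.add (continuousOn_Gk p true k)).sub
    ((continuousOn_Gk p false k).comp (by fun_prop) mapsTo_one_sub_Icc)

lemma mapsTo_vgf (p : Measure GameS) [IsProbabilityMeasure p] (k : ℝ≥0) :
    MapsTo (vgf p k) (Icc 0 1) (Icc 0 1) := by
  have h₀ : (0 : ℝ) ∈ Icc (0 : ℝ) 1 := left_mem_Icc.2 zero_le_one
  have h₁ : (1 : ℝ) ∈ Icc (0 : ℝ) 1 := right_mem_Icc.2 zero_le_one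
  refine fun x hx => ⟨le_trans ?_ (monotoneOn_vgf p k h₀ hx hx.1),
    (monotoneOn_vgf p k hx h₁ hx.2).trans ?_⟩
  · have := Gk_true_one_add_Gk_false_one_le_one p k
    simp only [vgf, sub_zero]
    linarith
  · have hI := Gk_nonneg p true k le_rfl
    have hII := Gk_nonneg p false k le_rfl
    simp only [vgf, sub_self]
    linarith

/-- Kleene iteration on the unit interval: the iterates from `0` of a continuous monotone self-map
of `[0, 1]` increase to its least fixed point. -/
lemma exists_isLeast_fixedPoints_tendsto_iterate {f : ℝ → ℝ}
    (hmaps : MapsTo f (Icc 0 1) (Icc 0 1)) (hmono : MonotoneOn f (Icc 0 1))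
    (hcont : ContinuousOn f (Icc 0 1)) :
    ∃ α : ℝ, IsLeast {x ∈ Icc (0 : ℝ) 1 | f x = x} α ∧
      Monotone (fun t : ℕ => f^[t] 0) ∧ Tendsto (fun t : ℕ => f^[t] 0) atTop (𝓝 α) := by
  have h₀ : (0 : ℝ) ∈ Icc (0 : ℝ) 1 := left_mem_Icc.2 zero_le_one
  have hmem (t : ℕ) : f^[t] 0 ∈ Icc (0 : ℝ) 1 := hmaps.iterate t h₀
  have hstep : Monotone fun t : ℕ => f^[t] 0 := by
    refine monotone_nat_of_le_succ fun t => ?_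
    induction t with
    | zero => exact (hmem 1).1
    | succ t ih =>
      simp only [Function.iterate_succ_apply'] at ih ⊢
      exact hmono (hmem t) (hmaps (hmem t)) ih
  have hlim := tendsto_atTop_ciSup hstep ⟨1, forall_mem_range.2 fun t => (hmem t).2⟩
  set α := ⨆ t : ℕ, f^[t] 0
  have hα : α ∈ Icc (0 : ℝ) 1 := isClosed_Icc.mem_of_tendsto hlim (.of_forall hmem)
  have hfα : f α = α := by
    have h := (hcont α hα).tendsto.comp
      (tendsto_nhdsWithin_iff.2 ⟨hlim, .of_forall hmem⟩)
    refine tendsto_nhds_unique h ?_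
    simpa only [Function.comp_def, ← Function.iterate_succ_apply'] using
      hlim.comp (tendsto_add_atTop_nat 1)
  refine ⟨α, ⟨⟨hα, hfα⟩, fun x hx => le_of_tendsto' hlim fun t => ?_⟩, hstep, hlim⟩
  induction t with
  | zero => exact hx.1.1
  | succ t ih =>
    rw [Function.iterate_succ_apply', ← hx.2]
    exact hmono (hmem t) hx.1 ih

/-- for `k ≥ 0`, `f_k` maps `[0,1]` into `[0,1]`, the set of its fixed
points in `[0,1]` has a smallest element `α_p(k)`, and the iterates
`a_t = f_k^{t+1}(0)` form a non-decreasing sequence converging to `α_p(k)`. -/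
theorem vgf_mapsTo_least_fixed_point_iterates
    (p : Measure GameS) [IsProbabilityMeasure p] (k : ℝ≥0) :
    Set.MapsTo (vgf p k) (Set.Icc (0:ℝ) 1) (Set.Icc (0:ℝ) 1) ∧
    ∃ α : ℝ, IsLeast {x ∈ Set.Icc (0:ℝ) 1 | vgf p k x = x} α ∧
      Monotone (fun t : ℕ => (vgf p k)^[t + 1] 0) ∧
      Tendsto (fun t : ℕ => (vgf p k)^[t + 1] 0) atTop (nhds α) := by
  obtain ⟨α, hα, hmono, hlim⟩ := exists_isLeast_fixedPoints_tendsto_iterate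
    (mapsTo_vgf p k) (monotoneOn_vgf p k) (continuousOn_vgf p k)
  exact ⟨mapsTo_vgf p k, α, hα, fun _ _ h => hmono (Nat.add_le_add_right h 1),
    hlim.comp (tendsto_add_atTop_nat 1)⟩
end

section
/- Suppose p is an activation-independent escape model with marginal μ on (γ,ξ) and Player I's activation probability q = p(ι = I). Fix k > 0, let m = ∫ 1_{γ≥k}·ξ dμ ∈ [0,∞] and g = μ({γ ≥ k} ∩ {ξ = 1}). Define the k-critical activation probability q_c(k) = 0 if m = ∞, q_c(k) = (1 − g)/(m − g) if 1 < m < ∞, and q_c(k) = 1 otherwise. Then α_p(k) < 1 if and only if q > q_c(k). -/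
open MeasureTheory Set Filter Topology
open scoped ENNReal NNReal

/-- `α_p(k)`: the smallest fixed point of `f_k` in `[0,1]`. -/
noncomputable def alphaP (p : Measure GameS) (k : ℝ≥0) : ℝ :=
  sInf {x ∈ Set.Icc (0:ℝ) 1 | vgf p k x = x}

/-- The activation-independent primitive distribution on `S` with Player I's activation
probability `q` and marginal `μ` on `(γ,ξ)`. -/
noncomputable def actMeasure (q : ℝ≥0∞) (μ : Measure (ℝ≥0 × ℕ)) : Measure GameS :=
  (q • Measure.dirac true + (1 - q) • Measure.dirac false).prod μ

/-- The masses of an escape model: `capMass μ k n = μ({γ ≥ k} ∩ {ξ = n})`. -/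
noncomputable def capMass (μ : Measure (ℝ≥0 × ℕ)) (k : ℝ≥0) (n : ℕ) : ℝ≥0∞ :=
  μ {s : ℝ≥0 × ℕ | k ≤ s.1 ∧ s.2 = n}

theorem measurableSet_capMass (k : ℝ≥0) (n : ℕ) :
    MeasurableSet {s : ℝ≥0 × ℕ | k ≤ s.1 ∧ s.2 = n} :=
  (measurableSet_le measurable_const measurable_fst).inter
    (measurable_snd (measurableSet_singleton n))

theorem pk_actMeasure_true (μ : Measure (ℝ≥0 × ℕ)) [IsProbabilityMeasure μ] (q : ℝ≥0∞)
    (k : ℝ≥0) (n : ℕ) :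
    pk (actMeasure q μ) true k n = q.toReal * (capMass μ k n).toReal := by
  have h : {s : GameS | s.1 = true ∧ k ≤ s.2.1 ∧ s.2.2 = n}
      = {true} ×ˢ {s : ℝ≥0 × ℕ | k ≤ s.1 ∧ s.2 = n} := by
    ext s; simp
  simp [pk, actMeasure, h, Measure.prod_prod, capMass]

theorem pk_actMeasure_false (μ : Measure (ℝ≥0 × ℕ)) [IsProbabilityMeasure μ] (q : ℝ≥0∞)
    (k : ℝ≥0) (n : ℕ) :
    pk (actMeasure q μ) false k n = (1 - q).toReal * (capMass μ k n).toReal := by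
  have h : {s : GameS | s.1 = false ∧ k ≤ s.2.1 ∧ s.2.2 = n}
      = {false} ×ˢ {s : ℝ≥0 × ℕ | k ≤ s.1 ∧ s.2 = n} := by
    ext s; simp
  simp [pk, actMeasure, h, Measure.prod_prod, capMass]

theorem tsum_capMass (μ : Measure (ℝ≥0 × ℕ)) (k : ℝ≥0) :
    ∑' n, capMass μ k n = μ {s : ℝ≥0 × ℕ | k ≤ s.1} := by
  have h : {s : ℝ≥0 × ℕ | k ≤ s.1} = ⋃ n, {s : ℝ≥0 × ℕ | k ≤ s.1 ∧ s.2 = n} := by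
    ext s; simp
  rw [h, measure_iUnion _ (measurableSet_capMass k)]
  · rfl
  · intro i j hij
    refine Set.disjoint_left.2 fun s hs ht => hij ?_
    exact hs.2.symm.trans ht.2

theorem lintegral_eq_tsum_capMass (μ : Measure (ℝ≥0 × ℕ)) (k : ℝ≥0) :
    ∫⁻ s in {s : ℝ≥0 × ℕ | k ≤ s.1}, (s.2 : ℝ≥0∞) ∂μ = ∑' n : ℕ, (n : ℝ≥0∞) * capMass μ k n := by
  rw [← lintegral_map (f := fun n : ℕ => (n : ℝ≥0∞)) (g := Prod.snd)
    (measurable_from_top) measurable_snd, lintegral_countable']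
  refine tsum_congr fun n => ?_
  rw [Measure.map_apply measurable_snd (measurableSet_singleton n),
    Measure.restrict_apply (measurable_snd (measurableSet_singleton n)), capMass]
  congr 2
  ext s
  simp [and_comm]

/-- The criterion `q > q_c` says that the slope `q m + (1 - q) g` exceeds one. -/
theorem critical_lt_iff {q m g : ℝ≥0∞} (hq : q ≤ 1) (hg : g < 1) (hgm : g ≤ m) :
    (if m = ⊤ then 0 else if 1 < m then (1 - g) / (m - g) else 1) < q
      ↔ 1 < q * m + (1 - q) * g := by
  split_ifs with h1 h2
  · subst h1
    rcases eq_or_ne q 0 with rfl | h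
    · simpa using hg.le
    · simp [ENNReal.mul_top h, pos_iff_ne_zero, h]
  all_goals
    lift m to ℝ≥0 using h1
    lift g to ℝ≥0 using hg.ne_top
    lift q to ℝ≥0 using (hq.trans_lt ENNReal.one_lt_top).ne
    norm_cast at *
  · rw [ENNReal.div_lt_iff]
    · norm_cast
      rw [← NNReal.coe_lt_coe, ← NNReal.coe_lt_coe]
      push_cast [NNReal.coe_sub hq, NNReal.coe_sub hg.le, NNReal.coe_sub hgm]
      constructor <;> intro h <;> nlinarith
    · left
      norm_cast
      exact (tsub_pos_of_lt (hg.trans h2)).ne'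
    · left
      norm_cast
      exact ENNReal.coe_ne_top
  · refine iff_of_false hq.not_gt (not_lt.2 ?_)
    rw [← NNReal.coe_le_coe]
    push_cast [NNReal.coe_sub hq]
    have h2' : (m : ℝ) ≤ 1 := by exact_mod_cast not_lt.1 h2
    have hg' : (g : ℝ) ≤ 1 := by exact_mod_cast hg.le
    have hq' : (q : ℝ) ≤ 1 := by exact_mod_cast hq
    nlinarith [q.coe_nonneg]

/-- The power series with nonnegative summable coefficients is continuous on `[0,1]`. -/
theorem continuousOn_tsum_mul_pow {a : ℕ → ℝ} (ha : ∀ n, 0 ≤ a n) (hs : Summable a) :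
    ContinuousOn (fun x : ℝ => ∑' n, a n * x ^ n) (Icc 0 1) := by
  refine continuousOn_tsum (fun n => by fun_prop) hs fun n x hx => ?_
  rw [Real.norm_of_nonneg (mul_nonneg (ha n) (pow_nonneg hx.1 n))]
  exact mul_le_of_le_one_right (ha n) (pow_le_one₀ hx.1 hx.2)

theorem summable_mul_pow {a : ℕ → ℝ} (ha : ∀ n, 0 ≤ a n) (hs : Summable a) {x : ℝ}
    (hx : x ∈ Icc (0 : ℝ) 1) : Summable fun n => a n * x ^ n :=
  hs.of_nonneg_of_le (fun n => mul_nonneg (ha n) (pow_nonneg hx.1 n)) fun n =>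
    mul_le_of_le_one_right (ha n) (pow_le_one₀ hx.1 hx.2)

/-- The value generating function in the variable `y = 1 - x`, reflected at its fixed point
`x = 1`, for the mass sequence `a`. -/
noncomputable def reflectedVgf (a : ℕ → ℝ) (Q y : ℝ) : ℝ :=
  Q * (∑' n, a n - ∑' n, a n * (1 - y) ^ n) + (1 - Q) * ∑' n, a n * y ^ n

theorem hasSum_reflectedVgf {a : ℕ → ℝ} (ha : ∀ n, 0 ≤ a n) (hs : Summable a) (Q : ℝ) {y : ℝ}
    (hy : y ∈ Icc (0 : ℝ) 1) :
    HasSum (fun n => a n * (Q * (1 - (1 - y) ^ n) + (1 - Q) * y ^ n)) (reflectedVgf a Q y) := by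
  have hy' : 1 - y ∈ Icc (0 : ℝ) 1 := ⟨by linarith [hy.2], by linarith [hy.1]⟩
  have h := ((hs.hasSum.sub (summable_mul_pow ha hs hy').hasSum).mul_left Q).add
    ((summable_mul_pow ha hs hy).hasSum.mul_left (1 - Q))
  have hterm : (fun n => a n * (Q * (1 - (1 - y) ^ n) + (1 - Q) * y ^ n))
      = fun n => Q * (a n - a n * (1 - y) ^ n) + (1 - Q) * (a n * y ^ n) := by
    funext n
    ring
  rw [hterm]
  exact h

theorem one_sub_one_sub_pow_le {y : ℝ} (hy : y ∈ Icc (0 : ℝ) 1) (n : ℕ) :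
    1 - (1 - y) ^ (n + 1) ≤ y * ((1 - y) * (n + 1 : ℕ) + y) := by
  obtain ⟨h0, h1⟩ := hy
  induction n with
  | zero => simp
  | succ n ih =>
    have h : (1 - y) ^ (n + 1) ≤ 1 - y := by
      rw [pow_succ]
      exact mul_le_of_le_one_left (by linarith) (pow_le_one₀ (by linarith) (by linarith))
    have e : 1 - (1 - y) ^ (n + 1 + 1) = (1 - (1 - y) ^ (n + 1)) + y * (1 - y) ^ (n + 1) := by
      ring
    rw [e]
    push_cast at ih ⊢
    nlinarith

/-- The chord bound coming from convexity of each term of `reflectedVgf a Q y / y`. -/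
theorem reflectedVgf_term_le {y Q : ℝ} (hy : y ∈ Icc (0 : ℝ) 1) (hQ : Q ∈ Icc (0 : ℝ) 1) (n : ℕ) :
    Q * (1 - (1 - y) ^ (n + 1)) + (1 - Q) * y ^ (n + 1)
      ≤ y * ((1 - y) * (Q * (n + 1 : ℕ) + if n + 1 = 1 then 1 - Q else 0) + y) := by
  have h := mul_le_mul_of_nonneg_left (one_sub_one_sub_pow_le hy n) hQ.1
  obtain ⟨h0, h1⟩ := hy
  rcases n with _ | n
  · simp
    linarith
  · have h2 : y ^ (n + 1 + 1) ≤ y * y := by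
      rw [pow_succ, pow_succ, mul_assoc]
      exact mul_le_of_le_one_left (by positivity) (pow_le_one₀ h0 h1)
    have h3 := mul_le_mul_of_nonneg_left h2 (sub_nonneg.2 hQ.2)
    simp only [Nat.add_eq_right, Nat.add_eq_zero_iff, one_ne_zero, and_false, if_false]
    nlinarith

theorem reflectedVgf_lt {a : ℕ → ℝ} (ha : ∀ n, 0 ≤ a n) (h0 : a 0 = 0) (hs : Summable a)
    (hlt : ∑' n, a n < 1) {Q : ℝ} (hQ : Q ∈ Icc (0 : ℝ) 1)
    (hL : ∀ N, ∑ n ∈ Finset.range N, a n * (Q * n + if n = 1 then 1 - Q else 0) ≤ 1)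
    {y : ℝ} (hy : y ∈ Icc (0 : ℝ) 1) (hpos : 0 < y) : reflectedVgf a Q y < y := by
  have key : reflectedVgf a Q y ≤ y * ((1 - y) + y * ∑' n, a n) := by
    refine le_of_tendsto (hasSum_reflectedVgf ha hs Q hy).tendsto_sum_nat
      (Eventually.of_forall fun N => ?_)
    calc _ ≤ ∑ n ∈ Finset.range N,
          (y * (1 - y) * (a n * (Q * n + if n = 1 then 1 - Q else 0)) + y * y * a n) := by
          refine Finset.sum_le_sum fun n _ => ?_
          rcases n with _ | n
          · simp [h0]
          · refine (mul_le_mul_of_nonneg_left (reflectedVgf_term_le hy hQ n) (ha _)).trans_eq ?_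
            ring
      _ ≤ y * (1 - y) * 1 + y * y * ∑' n, a n := by
          rw [Finset.sum_add_distrib, ← Finset.mul_sum, ← Finset.mul_sum]
          gcongr
          · exact mul_nonneg hy.1 (sub_nonneg.2 hy.2)
          · exact hL N
          · exact hs.sum_le_tsum _ fun n _ => ha n
      _ = _ := by ring
  nlinarith [mul_pos hpos hpos]

theorem exists_lt_reflectedVgf {a : ℕ → ℝ} (ha : ∀ n, 0 ≤ a n) (hs : Summable a)
    {Q : ℝ} (hQ : Q ∈ Icc (0 : ℝ) 1) {N : ℕ}
    (hL : 1 < ∑ n ∈ Finset.range N, a n * (Q * n + if n = 1 then 1 - Q else 0)) :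
    ∃ y ∈ Ioo (0 : ℝ) 1, y < reflectedVgf a Q y := by
  let φ : ℝ → ℝ := fun y => ∑ n ∈ Finset.range N,
    a n * (Q * (∑ j ∈ Finset.range n, (1 - y) ^ j) + if n = 1 then 1 - Q else 0)
  have hφ : Continuous φ := by fun_prop
  have hφ0 : 1 < φ 0 := by simpa [φ] using hL
  have hev : ∀ᶠ y in 𝓝[>] (0 : ℝ), 1 < φ y ∧ y ∈ Ioo (0 : ℝ) 1 :=
    Eventually.and (nhdsWithin_le_nhds (hφ.continuousAt.eventually (lt_mem_nhds hφ0)))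
      (Ioo_mem_nhdsGT one_pos)
  obtain ⟨y, h1, hy⟩ := hev.exists
  refine ⟨y, hy, ?_⟩
  have hy' : y ∈ Icc (0 : ℝ) 1 := Ioo_subset_Icc_self hy
  have hpow : ∀ n : ℕ, 0 ≤ Q * (1 - (1 - y) ^ n) + (1 - Q) * y ^ n := fun n =>
    add_nonneg (mul_nonneg hQ.1 (sub_nonneg.2
      (pow_le_one₀ (by linarith [hy.2]) (by linarith [hy.1]))))
      (mul_nonneg (sub_nonneg.2 hQ.2) (pow_nonneg hy.1.le n))
  calc y < y * φ y := lt_mul_of_one_lt_right hy.1 h1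
    _ ≤ ∑ n ∈ Finset.range N, a n * (Q * (1 - (1 - y) ^ n) + (1 - Q) * y ^ n) := by
      rw [Finset.mul_sum]
      refine Finset.sum_le_sum fun n _ => ?_
      rw [mul_left_comm]
      refine mul_le_mul_of_nonneg_left ?_ (ha n)
      have hgeom : y * ∑ j ∈ Finset.range n, (1 - y) ^ j = 1 - (1 - y) ^ n := by
        simpa using mul_neg_geom_sum (1 - y) n
      rw [mul_add, mul_left_comm, hgeom]
      refine add_le_add_right ?_ _
      split_ifs with h
      · simp [h, mul_comm]
      · simpa using mul_nonneg (sub_nonneg.2 hQ.2) (pow_nonneg hy.1.le n)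
    _ ≤ reflectedVgf a Q y :=
      sum_le_hasSum _ (fun n _ => mul_nonneg (ha n) (hpow n)) (hasSum_reflectedVgf ha hs Q hy')

theorem exists_reflectedVgf_eq_iff {a : ℕ → ℝ} (ha : ∀ n, 0 ≤ a n) (h0 : a 0 = 0)
    (hs : Summable a) (hlt : ∑' n, a n < 1) {Q : ℝ} (hQ : Q ∈ Icc (0 : ℝ) 1) :
    (∃ y ∈ Ioc (0 : ℝ) 1, reflectedVgf a Q y = y) ↔
      ∃ N, 1 < ∑ n ∈ Finset.range N, a n * (Q * n + if n = 1 then 1 - Q else 0) := by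
  constructor
  · rintro ⟨y, hy, he⟩
    by_contra! hL
    exact (reflectedVgf_lt ha h0 hs hlt hQ hL (Ioc_subset_Icc_self hy) hy.1).ne he
  · rintro ⟨N, hL⟩
    obtain ⟨y, hy, hlt'⟩ := exists_lt_reflectedVgf ha hs hQ hL
    have hc := continuousOn_tsum_mul_pow ha hs
    have hcont : ContinuousOn (fun y => reflectedVgf a Q y - y) (Icc y 1) := by
      have hsub : Icc y 1 ⊆ Icc 0 1 := Icc_subset_Icc_left hy.1.le
      have hc' : ContinuousOn (fun x : ℝ => ∑' n, a n * (1 - x) ^ n) (Icc y 1) :=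
        hc.comp (f := fun x : ℝ => 1 - x) (by fun_prop) fun x hx =>
          ⟨by linarith [hx.2], by linarith [hx.1, hy.1]⟩
      exact ((continuousOn_const.mul (continuousOn_const.sub hc')).add
        (continuousOn_const.mul (hc.mono hsub))).sub continuousOn_id
    have hone : reflectedVgf a Q 1 = ∑' n, a n := by
      have hz : ∑' n, a n * (0 : ℝ) ^ n = 0 := by
        rw [tsum_eq_single 0 fun n hn => by simp [hn]]
        simp [h0]
      simp [reflectedVgf, hz]
      ring
    obtain ⟨z, hz, he⟩ := intermediate_value_Icc' hy.2.le hcont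
      (show (0 : ℝ) ∈ Icc _ _ from ⟨by linarith, by linarith⟩)
    exact ⟨z, ⟨hy.1.trans_le hz.1, hz.2⟩, sub_eq_zero.1 he⟩

theorem vgf_actMeasure (μ : Measure (ℝ≥0 × ℕ)) [IsProbabilityMeasure μ] {q : ℝ≥0∞} (hq : q ≤ 1)
    {k : ℝ≥0} (h0 : capMass μ k 0 = 0) (x : ℝ) :
    vgf (actMeasure q μ) k x
      = 1 - reflectedVgf (fun n => (capMass μ k n).toReal) q.toReal (1 - x) := by
  have hz : ∑' n, (capMass μ k n).toReal * (0 : ℝ) ^ n = 0 := by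
    rw [tsum_eq_single 0 fun n hn => by simp [hn]]
    simp [h0]
  simp only [vgf, Gk, pk_actMeasure_true, pk_actMeasure_false, mul_assoc, tsum_mul_left, hz,
    one_pow, mul_one, reflectedVgf, ENNReal.toReal_sub_of_le hq ENNReal.one_ne_top,
    ENNReal.toReal_one, sub_sub_cancel]
  ring

theorem alphaP_lt_one_iff_exists (p : Measure GameS) (k : ℝ≥0) (h1 : vgf p k 1 = 1) :
    alphaP p k < 1 ↔ ∃ x ∈ Ico (0 : ℝ) 1, vgf p k x = x := by
  have hbdd : BddBelow {x ∈ Icc (0 : ℝ) 1 | vgf p k x = x} := ⟨0, fun x hx => hx.1.1⟩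
  rw [alphaP, csInf_lt_iff hbdd ⟨1, by simp, h1⟩]
  constructor
  · rintro ⟨x, ⟨hx, he⟩, hlt⟩
    exact ⟨x, ⟨hx.1, hlt⟩, he⟩
  · rintro ⟨x, hx, he⟩
    exact ⟨x, ⟨Ico_subset_Icc_self hx, he⟩, hx.2⟩

theorem one_lt_slope_iff {c : ℕ → ℝ≥0∞} (hc : ∀ n, c n ≠ ⊤) {q : ℝ≥0∞} (hq : q ≤ 1) :
    1 < q * (∑' n : ℕ, (n : ℝ≥0∞) * c n) + (1 - q) * c 1 ↔
      ∃ N, 1 < ∑ n ∈ Finset.range N,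
        (c n).toReal * (q.toReal * n + if n = 1 then 1 - q.toReal else 0) := by
  have hq' : q ≠ ⊤ := (hq.trans_lt ENNReal.one_lt_top).ne
  have hsum : q * (∑' n : ℕ, (n : ℝ≥0∞) * c n) + (1 - q) * c 1
      = ∑' n : ℕ, c n * (q * n + if n = 1 then 1 - q else 0) := by
    simp_rw [mul_add]
    rw [ENNReal.tsum_add, ← ENNReal.tsum_mul_left]
    congr 1
    · exact tsum_congr fun n => by ring
    · rw [tsum_eq_single 1 fun n hn => by simp [hn]]
      simp [mul_comm]
  have hterm : ∀ n : ℕ, c n * (q * n + if n = 1 then 1 - q else 0) ≠ ⊤ := fun n => by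
    refine ENNReal.mul_ne_top (hc n)
      (ENNReal.add_ne_top.2 ⟨ENNReal.mul_ne_top hq' (ENNReal.natCast_ne_top n), ?_⟩)
    split_ifs
    · exact ENNReal.sub_ne_top ENNReal.one_ne_top
    · exact ENNReal.zero_ne_top
  rw [hsum, ENNReal.tsum_eq_iSup_nat, lt_iSup_iff]
  refine exists_congr fun N => ?_
  rw [← ENNReal.toReal_lt_toReal ENNReal.one_ne_top
    (ENNReal.sum_ne_top.2 fun n _ => hterm n), ENNReal.toReal_sum fun n _ => hterm n,
    ENNReal.toReal_one]
  refine iff_of_eq (congrArg _ (Finset.sum_congr rfl fun n _ => ?_))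
  split_ifs with h
  · rw [ENNReal.toReal_mul, ENNReal.toReal_add (ENNReal.mul_ne_top hq' (ENNReal.natCast_ne_top n))
      (ENNReal.sub_ne_top ENNReal.one_ne_top), ENNReal.toReal_mul, ENNReal.toReal_natCast,
      ENNReal.toReal_sub_of_le hq ENNReal.one_ne_top, ENNReal.toReal_one]
  · simp

/-- in an activation-independent escape model with marginal `μ` on `(γ,ξ)`
and activation probability `q`, for `k > 0`, with `m = ∫ 1_{γ≥k}·ξ dμ`,
`g = μ({γ ≥ k} ∩ {ξ = 1})` and `q_c(k)` defined as `0` if `m = ∞`, `(1−g)/(m−g)` if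
`1 < m < ∞`, and `1` otherwise, one has `α_p(k) < 1 ↔ q > q_c(k)`. -/
theorem alphaP_lt_one_iff_critical_activation
    (μ : Measure (ℝ≥0 × ℕ)) [IsProbabilityMeasure μ]
    (hesc1 : μ {s : ℝ≥0 × ℕ | 0 < s.1 ∧ s.2 = 0} = 0)
    (hesc2 : ∀ k : ℝ≥0, 0 < k → 0 < μ {s : ℝ≥0 × ℕ | s.1 < k})
    (q : ℝ≥0∞) (hq : q ≤ 1) (k : ℝ≥0) (hk : 0 < k)
    (m : ℝ≥0∞) (hm : m = ∫⁻ s in {s : ℝ≥0 × ℕ | k ≤ s.1}, (s.2 : ℝ≥0∞) ∂μ)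
    (g : ℝ≥0∞) (hg : g = μ {s : ℝ≥0 × ℕ | k ≤ s.1 ∧ s.2 = 1})
    (qc : ℝ≥0∞)
    (hqc : qc = if m = ⊤ then 0 else if 1 < m then (1 - g) / (m - g) else 1) :
    alphaP (actMeasure q μ) k < 1 ↔ qc < q := by
  have hzero : capMass μ k 0 = 0 :=
    measure_mono_null (t := {s : ℝ≥0 × ℕ | 0 < s.1 ∧ s.2 = 0})
      (fun _ hs => ⟨hk.trans_le hs.1, hs.2⟩) hesc1
  have htotal : ∑' n, capMass μ k n < 1 := by
    have hcompl : {s : ℝ≥0 × ℕ | k ≤ s.1} = {s : ℝ≥0 × ℕ | s.1 < k}ᶜ := by ext s; simp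
    rw [tsum_capMass, hcompl, prob_compl_eq_one_sub (measurableSet_lt measurable_fst
      measurable_const)]
    exact ENNReal.sub_lt_self ENNReal.one_ne_top one_ne_zero (hesc2 k hk).ne'
  have hfin : ∀ n, capMass μ k n ≠ ⊤ := fun n => measure_ne_top _ _
  have hsummable : Summable fun n => (capMass μ k n).toReal :=
    ENNReal.summable_toReal htotal.ne_top
  have htotal' : ∑' n, (capMass μ k n).toReal < 1 := by
    rw [← ENNReal.tsum_toReal_eq hfin, ← ENNReal.toReal_one]
    exact (ENNReal.toReal_lt_toReal htotal.ne_top ENNReal.one_ne_top).2 htotal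
  have hg' : g = capMass μ k 1 := hg
  have hm' := hm.trans (lintegral_eq_tsum_capMass μ k)
  have hgm : g ≤ m := by
    rw [hg', hm']
    simpa using ENNReal.le_tsum (f := fun n : ℕ => (n : ℝ≥0∞) * capMass μ k n) 1
  have hg1 : g < 1 := hg'.trans_lt ((ENNReal.le_tsum 1).trans_lt htotal)
  have hQ : q.toReal ∈ Icc (0 : ℝ) 1 :=
    ⟨ENNReal.toReal_nonneg, ENNReal.toReal_le_of_le_ofReal zero_le_one (by simpa using hq)⟩
  have hz : ∑' n, (capMass μ k n).toReal * (0 : ℝ) ^ n = 0 := by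
    rw [tsum_eq_single 0 fun n hn => by simp [hn]]
    simp [hzero]
  rw [hqc, critical_lt_iff hq hg1 hgm, hm', hg', one_lt_slope_iff hfin hq,
    ← exists_reflectedVgf_eq_iff (fun n => ENNReal.toReal_nonneg) (by simp [hzero]) hsummable
      htotal' hQ, alphaP_lt_one_iff_exists _ _ (by
      rw [vgf_actMeasure μ hq hzero]; simp [reflectedVgf, hz])]
  simp only [vgf_actMeasure μ hq hzero]
  constructor
  · rintro ⟨x, hx, he⟩
    exact ⟨1 - x, ⟨by linarith [hx.2], by linarith [hx.1]⟩, by linarith⟩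
  · rintro ⟨y, hy, he⟩
    refine ⟨1 - y, ⟨by linarith [hy.2], by linarith [hy.1]⟩, ?_⟩
    rw [sub_sub_cancel, he]
end
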